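/- For every α ∈ ℂ with α ≠ −1, the Bol algebra structure 𝔅₀₆^{1/(1+α)} on ℂ⁴, i.e. the structure given by [e₁,e₂]=e₃, [e₁,e₃]=e₄, [e₂,e₃]=e₄, [e₁,e₂,e₃]=e₄, [e₂,e₃,e₁]=(1/(1+α)−1)e₄, [e₁,e₃,e₂]=(1/(1+α))e₄, degenerates to the structure 𝓛₁₉^α given by [e₁,e₂]=e₄, [e₁,e₃]=e₄, [e₂,e₃]=e₄, [e₃,e₁,e₂]=e₄, [e₂,e₃,e₁]=α e₄, [e₁,e₂,e₃]=−(1+α)e₄. -/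

import Mathlib

open Filter Matrix Topology

/-- ℂ⁴ -/
abbrev V4 : Type := Fin 4 → ℂ

/-- GL₄(ℂ) -/
abbrev GL4 := Matrix.GeneralLinearGroup (Fin 4) ℂ

/-- structure constants of a bilinear map on ℂ⁴: `μ i j` is the value on `(eᵢ, eⱼ)`. -/
abbrev Bil4 := Fin 4 → Fin 4 → V4

/-- structure constants of a trilinear map on ℂ⁴. -/
abbrev Tril4 := Fin 4 → Fin 4 → Fin 4 → V4

/-- standard basis vectors -/
noncomputable def e4 (k : Fin 4) : V4 := Pi.single k (1 : ℂ)

/-- action of `g ∈ GL₄(ℂ)` on a bilinear map: `(g·μ)(x,y) = g μ(g⁻¹x, g⁻¹y)`,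
in structure constants. -/
noncomputable def actBil (g : GL4) (μ : Bil4) : Bil4 := fun i j =>
  (g : Matrix (Fin 4) (Fin 4) ℂ).mulVec
    (∑ p, ∑ q,
      (((g⁻¹ : GL4) : Matrix (Fin 4) (Fin 4) ℂ) p i *
       ((g⁻¹ : GL4) : Matrix (Fin 4) (Fin 4) ℂ) q j) • μ p q)

/-- action of `g ∈ GL₄(ℂ)` on a trilinear map:
`(g·τ)(x,y,z) = g τ(g⁻¹x, g⁻¹y, g⁻¹z)`, in structure constants. -/
noncomputable def actTril (g : GL4) (τ : Tril4) : Tril4 := fun i j k =>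
  (g : Matrix (Fin 4) (Fin 4) ℂ).mulVec
    (∑ p, ∑ q, ∑ r,
      (((g⁻¹ : GL4) : Matrix (Fin 4) (Fin 4) ℂ) p i *
       ((g⁻¹ : GL4) : Matrix (Fin 4) (Fin 4) ℂ) q j *
       ((g⁻¹ : GL4) : Matrix (Fin 4) (Fin 4) ℂ) r k) • τ p q r)

/-- `(μ,τ)` degenerates to `(lam,sig)`: there is a curve `g : ℂ∖{0} → GL₄(ℂ)` with
`g(t)·μ → lam` and `g(t)·τ → sig` as `t → 0`. -/
def Degenerates (μ : Bil4) (τ : Tril4) (lam : Bil4) (sig : Tril4) : Prop :=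
  ∃ g : ℂ → GL4,
    Tendsto (fun t => actBil (g t) μ) (𝓝[≠] (0 : ℂ)) (𝓝 lam) ∧
    Tendsto (fun t => actTril (g t) τ) (𝓝[≠] (0 : ℂ)) (𝓝 sig)

noncomputable def μB06 : Bil4 := fun i j =>
  if i = (0 : Fin 4) ∧ j = (1 : Fin 4) then e4 2
  else if i = (1 : Fin 4) ∧ j = (0 : Fin 4) then -(e4 2)
  else if i = (0 : Fin 4) ∧ j = (2 : Fin 4) then e4 3
  else if i = (2 : Fin 4) ∧ j = (0 : Fin 4) then -(e4 3)
  else if i = (1 : Fin 4) ∧ j = (2 : Fin 4) then e4 3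
  else if i = (2 : Fin 4) ∧ j = (1 : Fin 4) then -(e4 3)
  else 0

noncomputable def τB06inv (α : ℂ) : Tril4 := fun i j k =>
  if i = (0 : Fin 4) ∧ j = (1 : Fin 4) ∧ k = (2 : Fin 4) then e4 3
  else if i = (1 : Fin 4) ∧ j = (0 : Fin 4) ∧ k = (2 : Fin 4) then -(e4 3)
  else if i = (1 : Fin 4) ∧ j = (2 : Fin 4) ∧ k = (0 : Fin 4) then (1/(1 + α) - 1) • e4 3
  else if i = (2 : Fin 4) ∧ j = (1 : Fin 4) ∧ k = (0 : Fin 4) then -((1/(1 + α) - 1) • e4 3)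
  else if i = (0 : Fin 4) ∧ j = (2 : Fin 4) ∧ k = (1 : Fin 4) then (1/(1 + α)) • e4 3
  else if i = (2 : Fin 4) ∧ j = (0 : Fin 4) ∧ k = (1 : Fin 4) then -((1/(1 + α)) • e4 3)
  else 0

noncomputable def μL19 : Bil4 := fun i j =>
  if i = (0 : Fin 4) ∧ j = (1 : Fin 4) then e4 3
  else if i = (1 : Fin 4) ∧ j = (0 : Fin 4) then -(e4 3)
  else if i = (0 : Fin 4) ∧ j = (2 : Fin 4) then e4 3
  else if i = (2 : Fin 4) ∧ j = (0 : Fin 4) then -(e4 3)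
  else if i = (1 : Fin 4) ∧ j = (2 : Fin 4) then e4 3
  else if i = (2 : Fin 4) ∧ j = (1 : Fin 4) then -(e4 3)
  else 0

noncomputable def τL19 (α : ℂ) : Tril4 := fun i j k =>
  if i = (2 : Fin 4) ∧ j = (0 : Fin 4) ∧ k = (1 : Fin 4) then e4 3
  else if i = (0 : Fin 4) ∧ j = (2 : Fin 4) ∧ k = (1 : Fin 4) then -(e4 3)
  else if i = (1 : Fin 4) ∧ j = (2 : Fin 4) ∧ k = (0 : Fin 4) then α • e4 3
  else if i = (2 : Fin 4) ∧ j = (1 : Fin 4) ∧ k = (0 : Fin 4) then -(α • e4 3)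
  else if i = (0 : Fin 4) ∧ j = (1 : Fin 4) ∧ k = (2 : Fin 4) then (-(1 + α)) • e4 3
  else if i = (1 : Fin 4) ∧ j = (0 : Fin 4) ∧ k = (2 : Fin 4) then -((-(1 + α)) • e4 3)
  else 0

/-- the matrix `g(t)`, with `a = -(1+α)` -/
noncomputable def gMat (a t : ℂ) : Matrix (Fin 4) (Fin 4) ℂ :=
  !![1/a, 0, 0, 0; 0, 1/a, 0, 0; 0, 0, t, 0; 0, 0, 1/a^2, t/a]

/-- the inverse of `g(t)` -/
noncomputable def gInv (a t : ℂ) : Matrix (Fin 4) (Fin 4) ℂ :=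
  !![a, 0, 0, 0; 0, a, 0, 0; 0, 0, 1/t, 0; 0, 0, -1/(a*t^2), a/t]

lemma gMat_mul (a t : ℂ) (ha : a ≠ 0) (ht : t ≠ 0) : gMat a t * gInv a t = 1 := by
  ext i j
  fin_cases i <;> fin_cases j <;>
    simp [gMat, gInv, Matrix.mul_apply, Fin.sum_univ_four, ha, ht] <;> field_simp <;> ring

/-- the curve in GL₄ -/
noncomputable def gCurve (a : ℂ) (ha : a ≠ 0) (t : ℂ) : GL4 :=
  open Classical in
  if ht : t = 0 then 1 else
    ⟨gMat a t, gInv a t, gMat_mul a t ha ht,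
      mul_eq_one_comm.mp (gMat_mul a t ha ht)⟩

lemma gCurve_val (a : ℂ) (ha : a ≠ 0) (t : ℂ) (ht : t ≠ 0) :
    (gCurve a ha t : Matrix (Fin 4) (Fin 4) ℂ) = gMat a t := by
  simp [gCurve, ht]

lemma gCurve_inv (a : ℂ) (ha : a ≠ 0) (t : ℂ) (ht : t ≠ 0) :
    (((gCurve a ha t)⁻¹ : GL4) : Matrix (Fin 4) (Fin 4) ℂ) = gInv a t := by
  unfold gCurve
  rw [dif_neg ht]
  rfl

/-- the vanishing error term -/
noncomputable def errB : Bil4 := fun i j =>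
  if i = (0 : Fin 4) ∧ j = (1 : Fin 4) then e4 2
  else if i = (1 : Fin 4) ∧ j = (0 : Fin 4) then -(e4 2) else 0

lemma actBil_eq (a : ℂ) (ha : a ≠ 0) (t : ℂ) (ht : t ≠ 0) :
    actBil (gCurve a ha t) μB06 = μL19 + (t * a^2) • errB := by
  funext i j
  unfold actBil
  rw [gCurve_val a ha t ht, gCurve_inv a ha t ht]
  funext k
  fin_cases i <;> fin_cases j <;> fin_cases k <;>
    simp [gMat, gInv, Matrix.mulVec, dotProduct, Fin.sum_univ_four, μB06, μL19, errB, e4] <;>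
    field_simp <;> first | ring1 | simp | (left; ring1)

set_option maxHeartbeats 4000000 in
lemma actTril_eq (α : ℂ) (h : 1 + α ≠ 0) (ha : -(1 + α) ≠ 0) (t : ℂ) (ht : t ≠ 0) :
    actTril (gCurve (-(1 + α)) ha t) (τB06inv α) = τL19 α := by
  funext i j k
  unfold actTril
  rw [gCurve_val _ ha t ht, gCurve_inv _ ha t ht]
  have hα : α = -(-(1 + α)) - 1 := by ring
  generalize hb : -(1 + α) = a at *
  subst hα
  funext l
  fin_cases i <;> fin_cases j <;> fin_cases k <;> fin_cases l <;>
    simp [gMat, gInv, Matrix.mulVec, dotProduct, Fin.sum_univ_four, τB06inv, τL19, e4] <;>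
    field_simp <;> first | ring1 | simp | (left; ring1)

/-- for every α ≠ -1, 𝔅₀₆^{1/(1+α)} degenerates to 𝓛₁₉^α. -/
theorem stmt10 : ∀ α : ℂ, α ≠ -1 →
    Degenerates μB06 (τB06inv α) μL19 (τL19 α) := by
  intro α hα
  have h : 1 + α ≠ 0 := fun h => hα (by linear_combination h)
  have ha : -(1 + α) ≠ 0 := neg_ne_zero.mpr h
  refine ⟨gCurve (-(1 + α)) ha, ?_, ?_⟩
  · have hlim : Tendsto (fun t : ℂ => μL19 + (t * (-(1 + α))^2) • errB) (𝓝[≠] (0 : ℂ))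
        (𝓝 μL19) := by
      have hc : Continuous (fun t : ℂ => μL19 + (t * (-(1 + α))^2) • errB) := by fun_prop
      have := hc.tendsto 0
      simp only [zero_mul, zero_smul, add_zero] at this
      exact this.mono_left nhdsWithin_le_nhds
    refine hlim.congr' ?_
    filter_upwards [self_mem_nhdsWithin] with t ht
    exact (actBil_eq _ ha t ht).symm
  · refine tendsto_const_nhds.congr' ?_
    filter_upwards [self_mem_nhdsWithin] with t ht
    exact (actTril_eq α h ha t ht).symm
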